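/- arXiv:2003.05412 — 2 statements merged into one kernel-verified Lean document; each statement's English description precedes it below -/
import Mathlib

section
/- Let z ∈ ϱ(H). Then: (i) ran(Σ) is dense in 𝔛 if and only if ker(G_z) = {0}; (ii) if ker(Σ) is dense in 𝔉 then ran(G_z) ∩ 𝔥₁ = {0}; (iii) if Σ : 𝔥₁ → 𝔛 is surjective then, for every self-adjoint operator Θ : dom(Θ) ⊆ 𝔛 → 𝔛, the set Z_{Σ,Θ} := {w ∈ ϱ(H) : Θ + M_w has a bounded inverse in B(𝔛)} contains ℂ ∖ ℝ. -/
noncomputable section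

open scoped ComplexInnerProductSpace
open ContinuousLinearMap Filter

variable {F X : Type*}
  [NormedAddCommGroup F] [InnerProductSpace ℂ F] [CompleteSpace F]
  [NormedAddCommGroup X] [InnerProductSpace ℂ X] [CompleteSpace X]

/-- `W R l z = 1 + (z - l) • R`; the point `z` belongs to the resolvent set of the
self-adjoint operator `H` iff `W R l z` is boundedly invertible, where
`R = (-H + λ₀)⁻¹` and `l = λ₀ ∈ ϱ(H) ∩ ℝ` encode `H`. -/
def W (R : F →L[ℂ] F) (l : ℝ) (z : ℂ) : F →L[ℂ] F := 1 + (z - (l : ℂ)) • R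

/-- The resolvent set `ϱ(H)` of `H`, encoded through `R = (-H + λ₀)⁻¹`. -/
def res (R : F →L[ℂ] F) (l : ℝ) : Set ℂ := {z | IsUnit (W R l z)}

/-- The resolvent `R_z = (-H + z)⁻¹`. -/
def Rz (R : F →L[ℂ] F) (l : ℝ) (z : ℂ) : F →L[ℂ] F := R ∘L Ring.inverse (W R l z)

/-- `G_z = (Σ R_z̄)*`, where the bounded operator `B = Σ ∘ R : 𝔉 →L 𝔛` encodes the
(graph-norm bounded) operator `Σ : 𝔥₁ → 𝔛`. -/
def Gz (R : F →L[ℂ] F) (B : F →L[ℂ] X) (l : ℝ) (z : ℂ) : X →L[ℂ] F :=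
  adjoint (B ∘L Ring.inverse (W R l (starRingEnd ℂ z)))

/-- `(-H + λ₀) ψ`, for `ψ ∈ dom H = ran R`. -/
def Hinv (R : F →L[ℂ] F) (ψ : F) : F := Function.invFun (⇑R) ψ

/-- `Σ ψ`, for `ψ ∈ dom H = ran R`. -/
def SigmaOf (R : F →L[ℂ] F) (B : F →L[ℂ] X) (ψ : F) : X := B (Hinv R ψ)

/-- `Q` is the resolvent `(-K + z)⁻¹` of the (in general unbounded) operator `K`. -/
def IsResolventAt (K : F →ₗ.[ℂ] F) (z : ℂ) (Q : F →L[ℂ] F) : Prop :=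
  (∀ ψ : F, Q ψ ∈ K.domain) ∧
  (∀ (ψ : F) (h : Q ψ ∈ K.domain), z • Q ψ - K ⟨Q ψ, h⟩ = ψ) ∧
  (∀ ψ : K.domain, Q (z • (ψ : F) - K ψ) = (ψ : F))

/-- The resolvent set of the (in general unbounded) operator `K`. -/
def pres (K : F →ₗ.[ℂ] F) : Set ℂ := {z | ∃ Q : F →L[ℂ] F, IsResolventAt K z Q}

/-- `J ∈ B(𝔛)` is a two-sided bounded inverse of `Θ + M` (with domain `dom Θ`). -/
def IsBoundedInvOf (Θ : X →ₗ.[ℂ] X) (M : X → X) (J : X →L[ℂ] X) : Prop :=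
  (∀ y : X, J y ∈ Θ.domain) ∧
  (∀ (y : X) (h : J y ∈ Θ.domain), Θ ⟨J y, h⟩ + M (J y) = y) ∧
  (∀ x : Θ.domain, J (Θ x + M (x : X)) = (x : X))

/-- The set `Z_{Σ,Θ} = {z ∈ ϱ(H) : Θ + M_z` has a bounded inverse in `B(𝔛)}`,
where `M_z = Σ (G - G_z)`. -/
def ZSet (R : F →L[ℂ] F) (B : F →L[ℂ] X) (l : ℝ) (Θ : X →ₗ.[ℂ] X) : Set ℂ :=
  {z | z ∈ res R l ∧ ∃ J : X →L[ℂ] X,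
    IsBoundedInvOf Θ (fun x => SigmaOf R B ((Gz R B l l - Gz R B l z) x)) J}

theorem LinearPMap.im_inner_self_eq_zero {Θ : X →ₗ.[ℂ] X} (hΘ : IsSelfAdjoint Θ)
    (x : Θ.domain) : (⟪(x : X), Θ x⟫).im = 0 := by
  have h := LinearPMap.adjoint_isFormalAdjoint hΘ.dense_domain
  rw [LinearPMap.isSelfAdjoint_def.mp hΘ] at h
  have h2 := inner_im_symm (𝕜 := ℂ) (x : X) (Θ x)
  rw [h x x] at h2
  simp only [RCLike.im_to_complex] at h2
  linarith

/-- If the imaginary part of the quadratic form of `M` is bounded below, then `Θ + M` is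
boundedly invertible for every self-adjoint `Θ`. -/
theorem exists_isBoundedInvOf_of_le_im {Θ : X →ₗ.[ℂ] X} (hΘ : IsSelfAdjoint Θ)
    (M : X →L[ℂ] X) {c : ℝ} (hc : 0 < c) (hM : ∀ x, c * ‖x‖ ^ 2 ≤ |(⟪x, M x⟫).im|) :
    ∃ J : X →L[ℂ] X, IsBoundedInvOf Θ M J := by
  have bound (x : Θ.domain) : c * ‖(x : X)‖ ≤ ‖Θ x + M x‖ := by
    rcases eq_or_ne (x : X) 0 with h0 | h0
    · simp [h0]
    have h1 : |(⟪(x : X), M x⟫).im| ≤ ‖(x : X)‖ * ‖Θ x + M x‖ := by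
      have : (⟪(x : X), M x⟫).im = (⟪(x : X), Θ x + M x⟫).im := by
        rw [inner_add_right, Complex.add_im, LinearPMap.im_inner_self_eq_zero hΘ, zero_add]
      rw [this]
      exact (Complex.abs_im_le_norm _).trans (norm_inner_le_norm _ _)
    have hpos : 0 < ‖(x : X)‖ := norm_pos_iff.mpr h0
    have := (hM x).trans h1
    nlinarith
  let φ : Θ.graph →L[ℂ] X := (snd ℂ X X + M ∘L fst ℂ X X) ∘L Θ.graph.subtypeL
  have hφ (p : Θ.graph) : φ p = (p : X × X).2 + M (p : X × X).1 := rfl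
  have hclosed : IsClosed (Θ.graph : Set (X × X)) := hΘ.isClosed
  have : CompleteSpace Θ.graph := hclosed.completeSpace_coe
  have mem_graph (x : Θ.domain) : ((x : X), Θ x) ∈ Θ.graph := Θ.mem_graph x
  have hanti : ∀ p : Θ.graph, ‖p‖ ≤ (Real.toNNReal (c⁻¹ + 1 + ‖M‖ * c⁻¹)) * ‖φ p‖ := by
    rintro ⟨⟨a, b⟩, hp⟩
    obtain ⟨x, rfl, rfl⟩ := (LinearPMap.mem_graph_iff Θ).mp hp
    rw [hφ, Real.coe_toNNReal _ (by positivity)]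
    have hb : ‖(x : X)‖ ≤ c⁻¹ * ‖Θ x + M x‖ := by
      rw [inv_mul_eq_div, le_div_iff₀ hc, mul_comm]
      exact bound x
    have h2 : ‖Θ x‖ ≤ ‖Θ x + M x‖ + ‖M‖ * (c⁻¹ * ‖Θ x + M x‖) := by
      calc ‖Θ x‖ = ‖(Θ x + M x) - M x‖ := by simp
        _ ≤ ‖Θ x + M x‖ + ‖M x‖ := norm_sub_le _ _
        _ ≤ _ := by
          gcongr
          exact (M.le_opNorm _).trans (by gcongr)
    have h3 : 0 ≤ c⁻¹ * ‖Θ x + M x‖ := by positivity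
    have h4 : 0 ≤ ‖M‖ * (c⁻¹ * ‖Θ x + M x‖) := by positivity
    have h5 : 0 ≤ ‖Θ x + M x‖ := by positivity
    change max ‖(x : X)‖ ‖Θ x‖ ≤ _ * ‖Θ x + M x‖
    refine max_le ?_ ?_ <;> linarith
  have hA := AddMonoidHomClass.antilipschitz_of_bound φ hanti
  have hker : φ.ker = ⊥ := LinearMap.ker_eq_bot.mpr hA.injective
  have hcl : IsClosed (φ.range : Set X) :=
    hA.isClosed_range φ.uniformContinuous
  have : CompleteSpace φ.range := hcl.completeSpace_coe
  have hrange : φ.range = ⊤ := by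
    rw [← Submodule.orthogonal_eq_bot_iff, Submodule.eq_bot_iff]
    intro y hy
    have hort (x : Θ.domain) : ⟪y, Θ x + M x⟫ = 0 :=
      (Submodule.mem_orthogonal' _ _).mp hy _ ⟨⟨_, mem_graph x⟩, rfl⟩
    have hmem : y ∈ Θ.domain := by
      rw [← LinearPMap.isSelfAdjoint_def.mp hΘ]
      refine LinearPMap.mem_adjoint_domain_of_exists y ⟨-(adjoint M y), fun x => ?_⟩
      have := hort x
      rw [inner_add_right] at this
      rw [inner_neg_left, adjoint_inner_left]
      exact (eq_neg_of_add_eq_zero_left this).symm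
    have h0 := hort ⟨y, hmem⟩
    have h1 := congrArg Complex.im h0
    rw [inner_add_right, Complex.add_im, LinearPMap.im_inner_self_eq_zero hΘ ⟨y, hmem⟩] at h1
    have h2 := hM y
    simp only [zero_add, Complex.zero_im] at h1
    rw [h1, abs_zero] at h2
    have h3 : ‖y‖ ^ 2 ≤ 0 := by
      by_contra! h
      nlinarith [mul_pos hc h]
    simpa using h3
  let e := ContinuousLinearEquiv.ofBijective φ hker hrange
  have he (p : Θ.graph) : e p = (p : X × X).2 + M (p : X × X).1 := rfl
  refine ⟨fst ℂ X X ∘L Θ.graph.subtypeL ∘L (e.symm : X →L[ℂ] Θ.graph), fun y => ?_,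
    fun y h => ?_, fun x => ?_⟩
  · exact LinearPMap.mem_domain_of_mem_graph (e.symm y).2
  · have h1 := he (e.symm y)
    rw [e.apply_symm_apply] at h1
    have h2 := LinearPMap.mem_graph Θ ⟨_, h⟩
    have h3 := LinearPMap.mem_graph_snd_inj Θ h2 (e.symm y).2 rfl
    refine Eq.trans ?_ h1.symm
    congr 1
  · have h1 := he ⟨_, mem_graph x⟩
    change ((e.symm (Θ x + M x) : X × X)).1 = x
    rw [← h1, e.symm_apply_apply]

theorem ContinuousLinearMap.exists_pos_le_norm_adjoint_of_surjective (B : F →L[ℂ] X)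
    (hB : Function.Surjective B) : ∃ k > 0, ∀ x, k * ‖x‖ ≤ ‖adjoint B x‖ := by
  obtain ⟨C, hC, h⟩ := B.exists_preimage_norm_le hB
  refine ⟨C⁻¹, inv_pos.mpr hC, fun x => ?_⟩
  rw [inv_mul_eq_div, div_le_iff₀ hC]
  rcases eq_or_ne x 0 with rfl | h0
  · simp
  obtain ⟨u, rfl, hu⟩ := h x
  have h1 : ‖B u‖ ^ 2 ≤ ‖adjoint B (B u)‖ * ‖u‖ := by
    rw [← inner_self_eq_norm_sq (𝕜 := ℂ), ← adjoint_inner_left]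
    exact (RCLike.re_le_norm _).trans (norm_inner_le_norm _ _)
  have h2 : ‖adjoint B (B u)‖ * ‖u‖ ≤ ‖adjoint B (B u)‖ * (C * ‖B u‖) := by gcongr
  have := norm_pos_iff.mpr h0
  nlinarith

theorem adjoint_W {R : F →L[ℂ] F} (hR : IsSelfAdjoint R) (l : ℝ) (z : ℂ) :
    star (W R l z) = W R l (starRingEnd ℂ z) := by
  simp [W, hR.star_eq]

theorem Gz_eq {R : F →L[ℂ] F} (hR : IsSelfAdjoint R) (B : F →L[ℂ] X) (l : ℝ) (z : ℂ) :
    Gz R B l z = Ring.inverse (W R l z) ∘L adjoint B := by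
  have h : adjoint (Ring.inverse (W R l (starRingEnd ℂ z))) = Ring.inverse (W R l z) := by
    rw [← star_eq_adjoint, ← Ring.inverse_star, ← adjoint_W hR, star_star]
  rw [Gz, adjoint_comp, h]

theorem W_Gz {R : F →L[ℂ] F} (hR : IsSelfAdjoint R) (B : F →L[ℂ] X) {l : ℝ} {z : ℂ}
    (hz : z ∈ res R l) (x : X) : W R l z (Gz R B l z x) = adjoint B x := by
  rw [Gz_eq hR]
  exact congrArg (fun T : F →L[ℂ] F => T (adjoint B x)) (Ring.mul_inverse_cancel (W R l z) hz)

theorem W_injective {R : F →L[ℂ] F} {l : ℝ} {z : ℂ} (hz : z ∈ res R l) :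
    Function.Injective (W R l z) := by
  refine Function.LeftInverse.injective
    (g := (Ring.inverse (W R l z) : F →L[ℂ] F)) fun x => ?_
  exact congrArg (fun T : F →L[ℂ] F => T x) (Ring.inverse_mul_cancel _ hz)

theorem mem_res_of_im_ne_zero {R : F →L[ℂ] F} (hR : IsSelfAdjoint R) (l : ℝ) {w : ℂ}
    (hw : w.im ≠ 0) : w ∈ res R l := by
  have hne : w - l ≠ 0 := fun h => hw (by simpa using congrArg Complex.im h)
  have hs : -(w - l)⁻¹ ∉ spectrum ℂ R := by
    intro h
    have h1 := congrArg Complex.im (hR.mem_spectrum_eq_re h)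
    have : (w - l).im ≠ 0 := by simpa using hw
    simp [Complex.inv_im, hne, hw] at h1
  rw [spectrum.notMem_iff] at hs
  have h2 : W R l w = (-(w - l)) • (algebraMap ℂ (F →L[ℂ] F) (-(w - l)⁻¹) - R) := by
    rw [W, Algebra.algebraMap_eq_smul_one, smul_sub, smul_smul, neg_mul_neg,
      mul_inv_cancel₀ hne, one_smul, neg_smul, sub_neg_eq_add]
  change IsUnit (W R l w)
  rw [h2]
  exact hs.smul (Units.mk0 (-(w - l)) (neg_ne_zero.mpr hne))

theorem SigmaOf_Gz_sub {R : F →L[ℂ] F} (hR : IsSelfAdjoint R) (hinj : Function.Injective R)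
    (B : F →L[ℂ] X) {l : ℝ} {w : ℂ} (hw : w ∈ res R l) (x : X) :
    SigmaOf R B ((Gz R B l l - Gz R B l w) x) = (w - l) • B (Gz R B l w x) := by
  have h1 : Gz R B l l x = adjoint B x := by simp [Gz_eq hR, W]
  have h2 := W_Gz hR B hw x
  have h3 : (Gz R B l l - Gz R B l w) x = R ((w - l) • Gz R B l w x) := by
    rw [sub_apply, h1, ← h2]
    simp [W]
  rw [SigmaOf, Hinv, h3, Function.leftInverse_invFun hinj, map_smul]

theorem im_inner_smul_Gz {R : F →L[ℂ] F} (hR : IsSelfAdjoint R) (B : F →L[ℂ] X) {l : ℝ} {w : ℂ}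
    (hw : w ∈ res R l) (x : X) :
    (⟪x, (w - l) • B (Gz R B l w x)⟫).im = w.im * ‖Gz R B l w x‖ ^ 2 := by
  set f := Gz R B l w x with hf
  have h2 : adjoint B x = f + (w - l) • R f := by
    rw [← W_Gz hR B hw x]
    simp [W, ← hf]
  have h3 : (⟪R f, f⟫).im = 0 := hR.isSymmetric.im_inner_apply_self f
  rw [inner_smul_right, ← adjoint_inner_left, h2, inner_add_left, inner_smul_left,
    inner_self_eq_norm_sq_to_K]
  rw [mul_add, ← mul_assoc, Complex.mul_conj]
  simp [h3, ← Complex.ofReal_pow]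

theorem exists_pos_le_norm_Gz {R : F →L[ℂ] F} (hR : IsSelfAdjoint R) (B : F →L[ℂ] X)
    (hB : Function.Surjective B) {l : ℝ} {w : ℂ} (hw : w ∈ res R l) :
    ∃ k > 0, ∀ x, k * ‖x‖ ≤ ‖Gz R B l w x‖ := by
  obtain ⟨k, hk, h⟩ := B.exists_pos_le_norm_adjoint_of_surjective hB
  have hpos : 0 < ‖W R l w‖ + 1 := by positivity
  refine ⟨k / (‖W R l w‖ + 1), by positivity, fun x => ?_⟩
  rw [div_mul_eq_mul_div, div_le_iff₀ hpos]
  calc k * ‖x‖ ≤ ‖W R l w (Gz R B l w x)‖ := by rw [W_Gz hR B hw]; exact h x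
    _ ≤ ‖W R l w‖ * ‖Gz R B l w x‖ := le_opNorm _ _
    _ ≤ ‖Gz R B l w x‖ * (‖W R l w‖ + 1) := by nlinarith [norm_nonneg (Gz R B l w x)]

theorem ContinuousLinearMap.dense_range_iff_injective_adjoint (B : F →L[ℂ] X) :
    Dense (Set.range B) ↔ Function.Injective (adjoint B) := by
  have h1 : Dense (Set.range B) ↔ B.range.topologicalClosure = ⊤ := by
    rw [← Submodule.dense_iff_topologicalClosure_eq_top]
    rfl
  rw [h1, Submodule.topologicalClosure_eq_top_iff, orthogonal_range]
  exact LinearMap.ker_eq_bot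

/-- Let `z ∈ ϱ(H)`.  (i) `ran Σ` is dense in `𝔛` iff `ker G_z = {0}`;
(ii) if `ker Σ` is dense in `𝔉` then `ran G_z ∩ 𝔥₁ = {0}`;
(iii) if `Σ` is surjective onto `𝔛` then `Z_{Σ,Θ} ⊇ ℂ ∖ ℝ` for every self-adjoint `Θ`.
(Here `ran Σ = ran B` and `ker Σ = R (ker B)`, since `B = Σ ∘ R` and `R : 𝔉 → 𝔥₁` is a
bijection.) -/
theorem statement2
    (R : F →L[ℂ] F) (B : F →L[ℂ] X) (l : ℝ)
    (hR : IsSelfAdjoint R) (hinj : Function.Injective ⇑R)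
    (z : ℂ) (hz : z ∈ res R l) :
    (Dense (Set.range ⇑B) ↔ Function.Injective ⇑(Gz R B l z)) ∧
    (Dense (⇑R '' {χ | B χ = 0}) →
      Set.range ⇑(Gz R B l z) ∩ Set.range ⇑R = {0}) ∧
    (Set.range ⇑B = Set.univ →
      ∀ Θ : X →ₗ.[ℂ] X, IsSelfAdjoint Θ →
        ∀ w : ℂ, w.im ≠ 0 → w ∈ ZSet R B l Θ) := by
  refine ⟨?_, fun hd => ?_, fun hB Θ hΘ w hw => ?_⟩
  · have hW : ⇑(adjoint B) = W R l z ∘ Gz R B l z := funext fun x => (W_Gz hR B hz x).symm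
    rw [B.dense_range_iff_injective_adjoint, hW, (W_injective hz).of_comp_iff]
  · refine Set.eq_singleton_iff_unique_mem.mpr ⟨⟨⟨0, map_zero _⟩, ⟨0, map_zero _⟩⟩, ?_⟩
    rintro _ ⟨⟨x, rfl⟩, ⟨y, hy⟩⟩
    have h1 : adjoint B x = R (W R l z y) := by
      rw [← W_Gz hR B hz, ← hy]
      simp [W]
    have h2 : W R l z y = 0 := by
      refine hd.eq_zero_of_inner_left ℂ ?_
      rintro _ ⟨χ, hχ, rfl⟩
      have hsymm : ⟪R (W R l z y), χ⟫ = ⟪W R l z y, R χ⟫ := hR.isSymmetric _ _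
      rw [← hsymm, ← h1, adjoint_inner_left, show B χ = 0 from hχ, inner_zero_right]
    have h3 : y = 0 := W_injective hz (by rw [h2, map_zero])
    rw [← hy, h3, map_zero]
  · have hres := mem_res_of_im_ne_zero hR l hw
    obtain ⟨k, hk, hG⟩ := exists_pos_le_norm_Gz hR B (Set.range_eq_univ.mp hB) hres
    have hc : 0 < |w.im| * k ^ 2 := by positivity
    obtain ⟨J, hJ⟩ := exists_isBoundedInvOf_of_le_im hΘ ((w - l) • B ∘L Gz R B l w) hc
      fun x => by
        change _ ≤ |(⟪x, (w - l) • B (Gz R B l w x)⟫).im|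
        rw [im_inner_smul_Gz hR B hres, abs_mul, abs_of_nonneg (sq_nonneg ‖Gz R B l w x‖),
          mul_assoc, ← mul_pow]
        gcongr
        exact hG x
    refine ⟨hres, J, ?_⟩
    convert hJ using 1
    exact funext fun x => SigmaOf_Gz_sub hR hinj B hres x
end
end

section
/- (Abstract Green's identity.) For all ψ, φ ∈ dom(S^×): ⟨S^×ψ, φ⟩ − ⟨ψ, S^×φ⟩ = (Σ_*ψ, Σ₀φ) − (Σ₀ψ, Σ_*φ). -/
noncomputable section

open scoped ComplexInnerProductSpace
open ContinuousLinearMap Filter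

variable {F X : Type*}
  [NormedAddCommGroup F] [InnerProductSpace ℂ F] [CompleteSpace F]
  [NormedAddCommGroup X] [InnerProductSpace ℂ X] [CompleteSpace X]

/-- At the reference point, `G_{λ₀} = (Σ R)*` is the adjoint of `B = Σ R`. -/
theorem Gz_ofReal_self (R : F →L[ℂ] F) (B : F →L[ℂ] X) (l : ℝ) :
    Gz R B l l = adjoint B := by
  have hW : W R l (starRingEnd ℂ l) = 1 := by simp [W]
  rw [Gz, hW, Ring.inverse_one]
  rfl

/-- abstract Green's identity.  For all `ψ, φ ∈ dom S^×`,
`⟨S^× ψ, φ⟩ - ⟨ψ, S^× φ⟩ = (Σ_* ψ, Σ₀ φ) - (Σ₀ ψ, Σ_* φ)`.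
Here `ψ = ψ₀ + G φψ = R χ + G φψ` (so that `S^× ψ = λ₀ ψ - χ`, `Σ₀ ψ = Σ ψ₀ = B χ`,
`Σ_* ψ = φψ`), and similarly for `φ = R χ' + G φ'`. -/
theorem statement4
    (R : F →L[ℂ] F) (B : F →L[ℂ] X) (l : ℝ)
    (hR : IsSelfAdjoint R) (hinj : Function.Injective ⇑R)
    (hkerG : Function.Injective ⇑(Gz R B l l))
    (hranG : Set.range ⇑(Gz R B l l) ∩ Set.range ⇑R = {0})
    (ψ ψ' χ χ' : F) (φ φ' : X)
    (hψ : ψ = R χ + Gz R B l l φ) (hψ' : ψ' = R χ' + Gz R B l l φ') :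
    ⟪(l : ℂ) • ψ - χ, ψ'⟫ - ⟪ψ, (l : ℂ) • ψ' - χ'⟫
      = ⟪φ, B χ'⟫ - ⟪B χ, φ'⟫ := by
  have hRsymm : ⟪R χ, χ'⟫ = ⟪χ, R χ'⟫ := hR.isSymmetric χ χ'
  have hl : ⟪(l : ℂ) • ψ, ψ'⟫ = ⟪ψ, (l : ℂ) • ψ'⟫ := by
    rw [inner_smul_left, inner_smul_right, Complex.conj_ofReal]
  have hχ : ⟪χ, ψ'⟫ = ⟪χ, R χ'⟫ + ⟪B χ, φ'⟫ := by
    rw [hψ', Gz_ofReal_self, inner_add_right, adjoint_inner_right]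
  have hχ' : ⟪ψ, χ'⟫ = ⟪R χ, χ'⟫ + ⟪φ, B χ'⟫ := by
    rw [hψ, Gz_ofReal_self, inner_add_left, adjoint_inner_left]
  rw [inner_sub_left, inner_sub_right, hl, hχ, hχ', hRsymm]
  ring
end
end
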